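/- Let d ≥ 2 be an integer. There exists a constant M_d > 0 (depending only on d) such that for every integer t ≥ 2, every canonical family (B_1, …, B_d) in ℝ^d with |B_i| = n_i for i = 1, …, d whose intersection hypergraph H is K_{t,…,t}^{(d)}-free satisfies: the number of hyperedges of H is at most M_d · g_t(n_1, …, n_d). -/

import Mathlib

open Set

/-- The axis-parallel box in `ℝ^d` with corner functions `lo` and `hi`. -/
def boxSet {d : ℕ} (lo hi : Fin d → ℝ) : Set (Fin d → ℝ) :=
  {x | ∀ i, x i ∈ Set.Icc (lo i) (hi i)}

/-- `S` is an axis-parallel box in `ℝ^d` with direction set `F`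
(degenerate coordinates allowed). -/
def IsBoxDir {d : ℕ} (S : Set (Fin d → ℝ)) (F : Set (Fin d)) : Prop :=
  ∃ lo hi : Fin d → ℝ, (∀ i, lo i ≤ hi i) ∧ S = boxSet lo hi ∧ F = {i | lo i < hi i}

/-- `S` is an axis-parallel box in `ℝ^d` (with some direction set). -/
def IsBox {d : ℕ} (S : Set (Fin d → ℝ)) : Prop :=
  ∃ lo hi : Fin d → ℝ, (∀ i, lo i ≤ hi i) ∧ S = boxSet lo hi

/-- The number of hyperedges of the `r`-partite `r`-uniform intersection hypergraph of
the indexed families `B j : Fin (n j) → Set α`. -/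
noncomputable def hyperedgeCount {α : Type} {r : ℕ} (n : Fin r → ℕ)
    (B : ∀ j : Fin r, Fin (n j) → Set α) : ℕ :=
  Nat.card {f : ∀ j : Fin r, Fin (n j) // (⋂ j, B j (f j)).Nonempty}

/-- The intersection hypergraph of the families `B j` is `K_{t,…,t}`-free:
there are no `t`-element subfamilies `S j ⊆ B j` all of whose transversal tuples
have a common point. -/
def KFree {α : Type} {r : ℕ} (t : ℕ) (n : Fin r → ℕ)
    (B : ∀ j : Fin r, Fin (n j) → Set α) : Prop :=
  ¬ ∃ S : ∀ j : Fin r, Finset (Fin (n j)),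
      (∀ j, (S j).card = t) ∧
      ∀ f : ∀ j : Fin r, Fin (n j), (∀ j, f j ∈ S j) → (⋂ j, B j (f j)).Nonempty

/-- `g_t(n_1, …, n_r) = t · n_1 ⋯ n_r · (1/n_1 + ⋯ + 1/n_r)`. -/
noncomputable def gZ {r : ℕ} (t : ℕ) (n : Fin r → ℕ) : ℝ :=
  (t : ℝ) * (∏ j, (n j : ℝ)) * (∑ j, 1 / (n j : ℝ))

/-- `F` is a 2-coherent direction-vector: for some `k`, the common directions of all
families other than `k` number at least two. -/
def TwoCoherent {d r : ℕ} (F : Fin r → Set (Fin d)) : Prop :=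
  ∃ k : Fin r, 2 ≤ Set.ncard {i : Fin d | ∀ j : Fin r, j ≠ k → i ∈ F j}

/-- A canonical family in `ℝ^d`: each box of `B i` has direction set `[d] \ {i}`. -/
def Canonical {d : ℕ} (n : Fin d → ℕ) (B : ∀ i : Fin d, Fin (n i) → Set (Fin d → ℝ)) : Prop :=
  ∀ i k, IsBoxDir (B i k) {j | j ≠ i}

/-- A separated family: canonical, and for each `i` no two boxes of `B i` have the same
`i`-th coordinate. -/
def Separated {d : ℕ} (n : Fin d → ℕ) (B : ∀ i : Fin d, Fin (n i) → Set (Fin d → ℝ)) : Prop :=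
  Canonical n B ∧ ∀ i, ∀ k l : Fin (n i), k ≠ l →
    ∀ x ∈ B i k, ∀ y ∈ B i l, x i ≠ y i

/-- A restricted family: separated, and any transversal of the first `d - 1` families
has a common point. -/
def Restricted {d : ℕ} (n : Fin d → ℕ) (B : ∀ i : Fin d, Fin (n i) → Set (Fin d → ℝ)) : Prop :=
  Separated n B ∧ ∀ f : ∀ i : Fin d, Fin (n i),
    (⋂ (i : Fin d) (_ : (i : ℕ) < d - 1), B i (f i)).Nonempty



namespace Zar

/-- crossing relation -/
def X {H V : Type} (R : H → V → Prop) (Q : V → H → Prop) (h : H) (v : V) : Prop := R h v ∧ Q v h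

/-- consecutive corner in the subfamilies `HS`, `VS` -/
structure Corner {H V : Type} [LinearOrder H] [LinearOrder V] (HS : Finset H) (VS : Finset V)
    (R : H → V → Prop) (Q : V → H → Prop) (h h' : H) (v v' : V) : Prop where
  hS : h ∈ HS
  hS' : h' ∈ HS
  vS : v ∈ VS
  vS' : v' ∈ VS
  c0 : X R Q h v
  c1 : X R Q h' v
  c2 : X R Q h v'
  lh : h < h'
  lv : v < v'
  nh : ∀ g ∈ HS, h < g → g < h' → ¬ X R Q g v
  nv : ∀ w ∈ VS, v < w → w < v' → ¬ X R Q h w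

section
variable {H V : Type} [LinearOrder H] [LinearOrder V]

def Rel0 (HS : Finset H) (VS : Finset V)
    (R : H → V → Prop) (Q : V → H → Prop) (a : H × H × V × V) (x : H) : Prop :=
  x = a.2.1 ∧ ∀ w ∈ VS, a.2.2.1 < w → ¬ X R Q a.2.1 w

def Rel1 (HS : Finset H) (VS : Finset V)
    (R : H → V → Prop) (Q : V → H → Prop) (a : H × H × V × V) (x : V) : Prop :=
  X R Q a.2.1 x ∧ a.2.2.1 < x ∧ (∀ w ∈ VS, a.2.2.1 < w → w < x → ¬ X R Q a.2.1 w) ∧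
    ∀ g ∈ HS, g < a.2.1 → ¬ X R Q g x

def Rel2 (HS : Finset H) (VS : Finset V)
    (R : H → V → Prop) (Q : V → H → Prop) (a : H × H × V × V) (x : H) : Prop :=
  a.1 < x ∧ x < a.2.1 ∧ ∃ w1 ∈ VS, X R Q a.2.1 w1 ∧ a.2.2.1 < w1 ∧
    (∀ w ∈ VS, a.2.2.1 < w → w < w1 → ¬ X R Q a.2.1 w) ∧ X R Q x w1 ∧
    (∀ g ∈ HS, x < g → g < a.2.1 → ¬ X R Q g w1) ∧
    ∀ w ∈ VS, w < w1 → ¬ X R Q x w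

def Rel3 (HS : Finset H) (VS : Finset V)
    (R : H → V → Prop) (Q : V → H → Prop) (a : H × H × V × V) (x : V) : Prop :=
  a.2.2.1 < x ∧ x < a.2.2.2 ∧ (∃ g ∈ HS, a.1 < g ∧ g < a.2.1 ∧ X R Q g x) ∧
    (∀ g ∈ HS, a.1 < g → g < a.2.1 → ∀ w ∈ VS, a.2.2.1 < w → w < x → ¬ X R Q g w) ∧
    (∀ w ∈ VS, a.2.2.1 < w → w ≤ x → ¬ X R Q a.2.1 w) ∧
    ∃ w1 ∈ VS, x < w1 ∧ X R Q a.2.1 w1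

/-- uniqueness from the upper left corner -/
lemma uniq_base {HS : Finset H} {VS : Finset V} {R : H → V → Prop} {Q : V → H → Prop}
    {h h' : H} {v v' : V} {g g' : H} {u u' : V}
    (A : Corner HS VS R Q h h' v v') (B : Corner HS VS R Q g g' u u')
    (e1 : h' = g') (e2 : v = u) : (h, h', v, v') = (g, g', u, u') := by
  subst e1 e2
  have e3 : h = g := by
    rcases lt_trichotomy h g with k | k | k
    · exact absurd B.c0 (A.nh g B.hS k B.lh)
    · exact k
    · exact absurd A.c0 (B.nh h A.hS k A.lh)
  subst e3
  have e4 : v' = u' := by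
    rcases lt_trichotomy v' u' with k | k | k
    · exact absurd A.c2 (B.nv v' A.vS' A.lv k)
    · exact k
    · exact absurd B.c2 (A.nv u' B.vS' B.lv k)
  subst e4
  rfl

lemma uniq0 {HS : Finset H} {VS : Finset V} {R : H → V → Prop} {Q : V → H → Prop}
    {h h' : H} {v v' : V} {g g' : H} {u u' : V} {x : H}
    (A : Corner HS VS R Q h h' v v') (B : Corner HS VS R Q g g' u u')
    (a : Rel0 HS VS R Q (h, h', v, v') x) (b : Rel0 HS VS R Q (g, g', u, u') x) :
    (h, h', v, v') = (g, g', u, u') := by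
  obtain ⟨a1, a2⟩ := a
  obtain ⟨b1, b2⟩ := b
  dsimp only at *
  have e : h' = g' := a1.symm.trans b1
  subst e
  refine uniq_base A B rfl ?_
  rcases lt_trichotomy v u with k | k | k
  · exact absurd B.c1 (a2 u B.vS k)
  · exact k
  · exact absurd A.c1 (b2 v A.vS k)

lemma uniq_v {HS : Finset H} {VS : Finset V} {R : H → V → Prop} {Q : V → H → Prop}
    {h h' : H} {v v' : V} {g g' : H} {u u' : V} {x : V}
    (A : Corner HS VS R Q h h' v v') (B : Corner HS VS R Q g g' u u') (e : h' = g')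
    (av : v < x) (bv : u < x)
    (a : ∀ w ∈ VS, v < w → w < x → ¬ X R Q h' w) 
    (b : ∀ w ∈ VS, u < w → w < x → ¬ X R Q g' w) :
    (h, h', v, v') = (g, g', u, u') := by
  subst e
  refine uniq_base A B rfl ?_
  rcases lt_trichotomy v u with k | k | k
  · exact absurd B.c1 (a u B.vS k bv)
  · exact k
  · exact absurd A.c1 (b v A.vS k av)

lemma uniq1 {HS : Finset H} {VS : Finset V} {R : H → V → Prop} {Q : V → H → Prop}
    {h h' : H} {v v' : V} {g g' : H} {u u' : V} {x : V}
    (A : Corner HS VS R Q h h' v v') (B : Corner HS VS R Q g g' u u')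
    (a : Rel1 HS VS R Q (h, h', v, v') x) (b : Rel1 HS VS R Q (g, g', u, u') x) :
    (h, h', v, v') = (g, g', u, u') := by
  obtain ⟨a1, a2, a3, a4⟩ := a
  obtain ⟨b1, b2, b3, b4⟩ := b
  dsimp only at *
  refine uniq_v A B ?_ a2 b2 a3 b3
  rcases lt_trichotomy h' g' with k | k | k
  · exact absurd a1 (b4 _ A.hS' k)
  · exact k
  · exact absurd b1 (a4 _ B.hS' k)

lemma uniq2 {HS : Finset H} {VS : Finset V} {R : H → V → Prop} {Q : V → H → Prop}
    {h h' : H} {v v' : V} {g g' : H} {u u' : V} {x : H}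
    (A : Corner HS VS R Q h h' v v') (B : Corner HS VS R Q g g' u u')
    (a : Rel2 HS VS R Q (h, h', v, v') x) (b : Rel2 HS VS R Q (g, g', u, u') x) :
    (h, h', v, v') = (g, g', u, u') := by
  obtain ⟨a1, a2, w1, a3, a4, a5, a6, a7, a8, a9⟩ := a
  obtain ⟨b1, b2, z1, b3, b4, b5, b6, b7, b8, b9⟩ := b
  dsimp only at *
  have e : w1 = z1 := by
    rcases lt_trichotomy w1 z1 with k | k | k
    · exact absurd a7 (b9 _ a3 k)
    · exact k
    · exact absurd b7 (a9 _ b3 k)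
  subst e
  refine uniq_v A B ?_ a5 b5 a6 b6
  rcases lt_trichotomy h' g' with k | k | k
  · exact absurd a4 (b8 _ A.hS' a2 k)
  · exact k
  · exact absurd b4 (a8 _ B.hS' b2 k)

lemma uniq3_aux {HS : Finset H} {VS : Finset V} {R : H → V → Prop} {Q : V → H → Prop}
    (hR : ∀ h a b c, a ≤ b → b ≤ c → R h a → R h c → R h b)
    (hQ : ∀ v a b c, a ≤ b → b ≤ c → Q v a → Q v c → Q v b)
    {h h' : H} {v v' : V} {g g' : H} {u u' : V} {x : V}
    (A : Corner HS VS R Q h h' v v') (B : Corner HS VS R Q g g' u u') (hx : x ∈ VS)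
    (a : Rel3 HS VS R Q (h, h', v, v') x) (b : Rel3 HS VS R Q (g, g', u, u') x) :
    ¬ h' < g' := by
  intro k
  obtain ⟨a1, a2, ⟨h2, a3, a4, a5, a6⟩, a7, a8, w1, a9, a10, a11⟩ := a
  obtain ⟨b1, b2, ⟨g2, b3, b4, b5, b6⟩, b7, b8, z1, b9, b10, b11⟩ := b
  dsimp only at *
  have gh : g < h' := by
    by_contra hc
    push Not at hc
    have q' : Q x h' := hQ x h2 h' g2 a5.le (hc.trans b4.le) a6.2 b6.2
    have r' : R h' x := hR h' v x w1 a1.le a10.le A.c1.1 a11.1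
    exact a8 x hx a1 le_rfl ⟨r', q'⟩
  have vu : v ≤ u := by
    by_contra hc
    push Not at hc
    exact b7 h' A.hS' gh k v A.vS hc a1 A.c1
  have r : R h' u := hR h' v u w1 vu (b1.le.trans a10.le) A.c1.1 a11.1
  have q : Q u h' := hQ u g h' g' gh.le k.le B.c0.2 B.c1.2
  exact B.nh h' A.hS' gh k ⟨r, q⟩

lemma half_exists {HS : Finset H} {VS : Finset V} {R : H → V → Prop} {Q : V → H → Prop}
    (hR : ∀ h a b c, a ≤ b → b ≤ c → R h a → R h c → R h b)
    (hQ : ∀ v a b c, a ≤ b → b ≤ c → Q v a → Q v c → Q v b)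
    {h h' : H} {v v' : V}
    (A : Corner HS VS R Q h h' v v') (hb : ¬ R h' v') :
    (∃ x ∈ HS, Rel0 HS VS R Q (h, h', v, v') x) ∨ (∃ x ∈ VS, Rel1 HS VS R Q (h, h', v, v') x) ∨
    (∃ x ∈ HS, Rel2 HS VS R Q (h, h', v, v') x) ∨
    (∃ x ∈ VS, Rel3 HS VS R Q (h, h', v, v') x) := by
  classical
  by_cases H0 : ∀ w ∈ VS, v < w → ¬ X R Q h' w
  · exact Or.inl ⟨h', A.hS', rfl, H0⟩
  push Not at H0
  obtain ⟨w0, hw0, hw0v, hw0X⟩ := H0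
  obtain ⟨v1, hv1, hmin⟩ := Finset.exists_min_image (VS.filter fun w => v < w ∧ X R Q h' w) id
    ⟨w0, by simp [hw0, hw0v, hw0X]⟩
  simp only [Finset.mem_filter, id] at hv1 hmin
  obtain ⟨v1S, vv1, X1⟩ := hv1
  have hnext : ∀ w ∈ VS, v < w → w < v1 → ¬ X R Q h' w := fun w hw h1 h2 h3 =>
    absurd (hmin w ⟨hw, h1, h3⟩) (not_le.mpr h2)
  have v1v' : v1 < v' := by
    by_contra hc
    push Not at hc
    exact hb (hR h' v v' v1 A.lv.le hc A.c1.1 X1.1)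
  have nX : ¬ X R Q h v1 := A.nv v1 v1S vv1 v1v'
  have Rhv1 : R h v1 := hR h v v1 v' vv1.le v1v'.le A.c0.1 A.c2.1
  have nQ : ¬ Q v1 h := fun q => nX ⟨Rhv1, q⟩
  by_cases H3 : ∃ w ∈ VS, v < w ∧ w < v1 ∧ ∃ g ∈ HS, h < g ∧ g < h' ∧ X R Q g w
  · obtain ⟨w3, hw3⟩ := H3
    obtain ⟨x, hx, xmin⟩ := Finset.exists_min_image
      (VS.filter fun w => v < w ∧ w < v1 ∧ ∃ g ∈ HS, h < g ∧ g < h' ∧ X R Q g w) id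
      ⟨w3, by simpa using hw3⟩
    simp only [Finset.mem_filter, id] at hx xmin
    obtain ⟨xS, vx, xv1, hg⟩ := hx
    refine Or.inr (Or.inr (Or.inr ⟨x, xS, vx, xv1.trans v1v', hg, ?_, ?_, v1, v1S, xv1, X1⟩))
    · intro g hg h1 h2 w hw h3 h4 h5
      exact absurd (xmin w ⟨hw, h3, lt_trans h4 xv1, g, hg, h1, h2, h5⟩) (not_le.mpr h4)
    · intro w hw h1 h2
      exact hnext w hw h1 (lt_of_le_of_lt h2 xv1)
  push Not at H3
  by_cases H1 : ∀ g ∈ HS, g < h' → ¬ X R Q g v1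
  · exact Or.inr (Or.inl ⟨v1, v1S, X1, vv1, hnext, H1⟩)
  push Not at H1
  obtain ⟨g0, hg0⟩ := H1
  obtain ⟨h1, hh1, hmax⟩ := Finset.exists_max_image (HS.filter fun g => g < h' ∧ X R Q g v1) id
    ⟨g0, by simpa using hg0⟩
  simp only [Finset.mem_filter, id] at hh1 hmax
  obtain ⟨h1S, h1h', Xh1⟩ := hh1
  have hh1 : h < h1 := by
    by_contra hc
    push Not at hc
    exact nQ (hQ v1 h1 h h' hc A.lh.le Xh1.2 X1.2)
  refine Or.inr (Or.inr (Or.inl ⟨h1, h1S, hh1, h1h', v1, v1S, X1, vv1, hnext, Xh1, ?_, ?_⟩))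
  · intro g hg k1 k2 k3
    exact absurd (hmax g ⟨hg, k2, k3⟩) (not_le.mpr k1)
  · intro w hw k1 k2
    rcases lt_or_ge v w with k | k
    · exact H3 w hw k k1 h1 h1S hh1 h1h' k2
    · exact A.nh h1 h1S hh1 h1h' ⟨hR h1 w v v1 k vv1.le k2.1 Xh1.1,
        hQ v h h1 h' hh1.le h1h'.le A.c0.2 A.c1.2⟩

lemma half_count {HS : Finset H} {VS : Finset V} {R : H → V → Prop} {Q : V → H → Prop}
    (hR : ∀ h a b c, a ≤ b → b ≤ c → R h a → R h c → R h b)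
    (hQ : ∀ v a b c, a ≤ b → b ≤ c → Q v a → Q v c → Q v b)
    (S : Finset (H × H × V × V))
    (hS : ∀ a ∈ S, Corner HS VS R Q a.1 a.2.1 a.2.2.1 a.2.2.2 ∧ ¬ R a.2.1 a.2.2.2) :
    S.card ≤ 2 * (HS.card + VS.card) := by
  classical
  let r : H × H × V × V → (H ⊕ V) ⊕ (H ⊕ V) → Prop := fun a z =>
    match z with
    | Sum.inl (Sum.inl x) => Rel0 HS VS R Q a x
    | Sum.inl (Sum.inr x) => Rel1 HS VS R Q a x
    | Sum.inr (Sum.inl x) => Rel2 HS VS R Q a x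
    | Sum.inr (Sum.inr x) => Rel3 HS VS R Q a x
  have key := Finset.card_le_card_of_forall_subsingleton (s := S)
    (t := (HS.disjSum VS).disjSum (HS.disjSum VS)) r ?_ ?_
  · simp only [Finset.card_disjSum] at key
    omega
  · rintro ⟨h, h', v, v'⟩ ha
    obtain ⟨A, hb⟩ := hS _ ha
    rcases half_exists hR hQ A hb with ⟨x, hx, h⟩ | ⟨x, hx, h⟩ | ⟨x, hx, h⟩ | ⟨x, hx, h⟩
    · exact ⟨Sum.inl (Sum.inl x), by simpa using hx, h⟩
    · exact ⟨Sum.inl (Sum.inr x), by simpa using hx, h⟩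
    · exact ⟨Sum.inr (Sum.inl x), by simpa using hx, h⟩
    · exact ⟨Sum.inr (Sum.inr x), by simpa using hx, h⟩
  · rintro ((x | x) | (x | x)) hx ⟨h, h', v, v'⟩ ⟨ha, ha'⟩ ⟨g, g', u, u'⟩ ⟨hb, hb'⟩
    · exact uniq0 (hS _ ha).1 (hS _ hb).1 ha' hb'
    · exact uniq1 (hS _ ha).1 (hS _ hb).1 ha' hb'
    · exact uniq2 (hS _ ha).1 (hS _ hb).1 ha' hb'
    · have hx : x ∈ VS := by simpa using hx
      have e1 := uniq3_aux hR hQ (hS _ ha).1 (hS _ hb).1 hx ha' hb'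
      have e2 := uniq3_aux hR hQ (hS _ hb).1 (hS _ ha).1 hx hb' ha'
      refine uniq_v (hS _ ha).1 (hS _ hb).1 (le_antisymm (not_lt.mp e2) (not_lt.mp e1))
        ha'.1 hb'.1 ?_ ?_
      · exact fun w hw k1 k2 => ha'.2.2.2.2.1 w hw k1 k2.le
      · exact fun w hw k1 k2 => hb'.2.2.2.2.1 w hw k1 k2.le

lemma Corner.swap {HS : Finset H} {VS : Finset V} {R : H → V → Prop} {Q : V → H → Prop}
    {h h' : H} {v v' : V} (A : Corner HS VS R Q h h' v v') : Corner VS HS Q R v v' h h' where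
  hS := A.vS
  hS' := A.vS'
  vS := A.hS
  vS' := A.hS'
  c0 := A.c0.symm
  c1 := A.c2.symm
  c2 := A.c1.symm
  lh := A.lv
  lv := A.lh
  nh := fun g hg h1 h2 h3 => A.nv g hg h1 h2 h3.symm
  nv := fun g hg h1 h2 h3 => A.nh g hg h1 h2 h3.symm

lemma corner_count {HS : Finset H} {VS : Finset V} {R : H → V → Prop} {Q : V → H → Prop}
    (hR : ∀ h a b c, a ≤ b → b ≤ c → R h a → R h c → R h b)
    (hQ : ∀ v a b c, a ≤ b → b ≤ c → Q v a → Q v c → Q v b)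
    (S : Finset (H × H × V × V))
    (hS : ∀ a ∈ S, Corner HS VS R Q a.1 a.2.1 a.2.2.1 a.2.2.2 ∧ ¬ X R Q a.2.1 a.2.2.2) :
    S.card ≤ 4 * (HS.card + VS.card) := by
  classical
  have h1 := half_count hR hQ (S.filter fun a => ¬ R a.2.1 a.2.2.2) (by
    intro a ha
    rw [Finset.mem_filter] at ha
    exact ⟨(hS a ha.1).1, ha.2⟩)
  have h2 := half_count (HS := VS) (VS := HS) hQ hR
    ((S.filter fun a => ¬ ¬ R a.2.1 a.2.2.2).image fun a => (a.2.2.1, a.2.2.2, a.1, a.2.1)) (by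
    intro b hb
    rw [Finset.mem_image] at hb
    obtain ⟨a, ha, rfl⟩ := hb
    rw [Finset.mem_filter, not_not] at ha
    exact ⟨(hS a ha.1).1.swap, fun q => (hS a ha.1).2 ⟨ha.2, q⟩⟩)
  rw [Finset.card_image_of_injective] at h2
  · have := Finset.card_filter_add_card_filter_not (s := S) (fun a => ¬ R a.2.1 a.2.2.2)
    omega
  · rintro ⟨a, b, c, d⟩ ⟨a', b', c', d'⟩ h
    simp only [Prod.mk.injEq] at h ⊢
    tauto
end

lemma color_count {Y : Type} [Fintype Y] [DecidableEq Y] (T : ℕ) [NeZero T] (P K : Finset Y)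
    (hPK : Disjoint P K) :
    ((Finset.univ.filter fun χ : Y → Fin T => (∀ x ∈ P, χ x = 0) ∧ ∀ x ∈ K, χ x ≠ 0).card : ℝ)
      = (T : ℝ) ^ (Fintype.card Y) * ((1 / T : ℝ) ^ P.card * (1 - 1 / T : ℝ) ^ K.card) := by
  have hT : (T : ℝ) ≠ 0 := by exact_mod_cast NeZero.ne T
  have hT1 : 1 ≤ T := Nat.one_le_iff_ne_zero.mpr (NeZero.ne T)
  have h1 : (Finset.univ.filter fun χ : Y → Fin T => (∀ x ∈ P, χ x = 0) ∧ ∀ x ∈ K, χ x ≠ 0)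
      = Fintype.piFinset fun x => if x ∈ P then {0} else if x ∈ K then {0}ᶜ else Finset.univ := by
    ext χ
    simp only [Finset.mem_filter, Finset.mem_univ, true_and, Fintype.mem_piFinset]
    constructor
    · rintro ⟨h1, h2⟩ x
      split_ifs with a b
      · simpa using h1 x a
      · simpa using h2 x b
      · simp
    · intro h
      refine ⟨fun x hx => ?_, fun x hx => ?_⟩
      · have := h x
        rw [if_pos hx] at this
        simpa using this
      · have := h x
        rw [if_neg (Finset.disjoint_right.mp hPK hx), if_pos hx] at this
        simpa using this
  rw [h1, Fintype.card_piFinset]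
  push_cast
  have h2 : ∀ x : Y, (((if x ∈ P then ({0} : Finset (Fin T)) else if x ∈ K then {0}ᶜ
      else Finset.univ).card : ℕ) : ℝ) = (T : ℝ) * ((if x ∈ P then (1 / T : ℝ) else 1) *
        (if x ∈ K then (1 - 1 / T : ℝ) else 1)) := by
    intro x
    by_cases a : x ∈ P
    · have b : x ∉ K := Finset.disjoint_left.mp hPK a
      simp [a, b, hT]
    · by_cases b : x ∈ K
      · simp only [a, b, if_true, if_false, Finset.card_compl, Fintype.card_fin,
          Finset.card_singleton]
        rw [Nat.cast_sub hT1]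
        field_simp
        simp
      · simp [a, b]
  rw [Finset.prod_congr rfl fun x _ => h2 x, Finset.prod_mul_distrib, Finset.prod_mul_distrib]
  simp [Finset.prod_const]

lemma pow_half (m k : ℕ) (hm : 1 ≤ m) (hk : k ≤ 4 * m) :
    (1 / 16 : ℝ) ≤ (1 - 1 / ((2 * m : ℕ) : ℝ)) ^ k := by
  have hm' : (1 : ℝ) ≤ m := by exact_mod_cast hm
  push_cast
  have h0 : (1 / (2 * m) : ℝ) ≤ 1 / 2 := by
    rw [div_le_div_iff₀ (by linarith) (by norm_num)]
    linarith
  have h0' : (0 : ℝ) ≤ 1 / (2 * m) := by positivity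
  have h1 : (1 / 2 : ℝ) ≤ (1 - 1 / (2 * m : ℝ)) ^ m := by
    have := one_add_mul_le_pow (a := -(1 / (2 * m : ℝ))) (by linarith) m
    have e : (1 : ℝ) + m * -(1 / (2 * m : ℝ)) = 1 / 2 := by
      field_simp
      norm_num
    rw [e] at this
    simpa [sub_eq_add_neg] using this
  calc (1 / 16 : ℝ) = (1 / 2) ^ 4 := by norm_num
    _ ≤ ((1 - 1 / (2 * m : ℝ)) ^ m) ^ 4 := by gcongr
    _ = (1 - 1 / (2 * m : ℝ)) ^ (4 * m) := by rw [← pow_mul, mul_comm m 4]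
    _ ≤ _ := pow_le_pow_of_le_one (by linarith) (by linarith) hk

structure Quad {H V : Type} [LinearOrder H] [LinearOrder V] (HB : H → H → V → Prop)
    (VB : V → V → H → Prop)
    (R : H → V → Prop) (Q : V → H → Prop) (h h' : H) (v v' : V) : Prop where
  c0 : X R Q h v
  c1 : X R Q h' v
  c2 : X R Q h v'
  c3 : ¬ X R Q h' v'
  lh : h < h'
  lv : v < v'
  nh : HB h h' v
  nv : VB v v' h

lemma plane_count {H V : Type} [LinearOrder H] [LinearOrder V] [Fintype H] [Fintype V]
    {R : H → V → Prop} {Q : V → H → Prop}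
    (hR : ∀ h a b c, a ≤ b → b ≤ c → R h a → R h c → R h b)
    (hQ : ∀ v a b c, a ≤ b → b ≤ c → Q v a → Q v c → Q v b)
    (m : ℕ) (hm : 1 ≤ m)
    (S : Finset (H × H × V × V))
    (hS : ∀ a ∈ S, Quad (fun h h' v => Set.ncard {g | h < g ∧ g < h' ∧ X R Q g v} ≤ 2 * m)
      (fun v v' h => Set.ncard {w | v < w ∧ w < v' ∧ X R Q h w} ≤ 2 * m)
      R Q a.1 a.2.1 a.2.2.1 a.2.2.2) :
    (S.card : ℝ) ≤ 64 * ((2 * m : ℕ) : ℝ) ^ 3 * (Fintype.card H + Fintype.card V) := by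
  classical
  obtain ⟨T, hT⟩ : ∃ T, T = 2 * m := ⟨_, rfl⟩
  have : NeZero T := ⟨by omega⟩
  have hT0 : (0 : ℝ) < T := by
    have : 0 < T := by omega
    exact_mod_cast this
  let P : H × H × V × V → Finset (H ⊕ V) := fun a =>
    ({a.1, a.2.1} : Finset H).disjSum {a.2.2.1, a.2.2.2}
  let K : H × H × V × V → Finset (H ⊕ V) := fun a =>
    (Finset.univ.filter fun g => a.1 < g ∧ g < a.2.1 ∧ X R Q g a.2.2.1).disjSum
     (Finset.univ.filter fun w => a.2.2.1 < w ∧ w < a.2.2.2 ∧ X R Q a.1 w)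
  let rel : H × H × V × V → (H ⊕ V → Fin T) → Prop := fun a χ =>
    (∀ x ∈ P a, χ x = 0) ∧ ∀ x ∈ K a, χ x ≠ 0
  have hdc := Finset.sum_card_bipartiteAbove_eq_sum_card_bipartiteBelow (s := S)
    (t := (Finset.univ : Finset (H ⊕ V → Fin T))) rel
  obtain ⟨N, hN⟩ : ∃ N, N = Fintype.card (H ⊕ V) := ⟨_, rfl⟩
  have hlow : ∀ a ∈ S, (T : ℝ) ^ N * ((1 / T : ℝ) ^ 4 * (1 / 16)) ≤
      ((Finset.univ.bipartiteAbove rel a).card : ℝ) := by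
    intro a ha
    have q := hS a ha
    have hd : Disjoint (P a) (K a) := by
      rw [Finset.disjoint_left]
      rintro (x | x) h1 h2
      · simp only [P, K, Finset.inl_mem_disjSum, Finset.mem_insert, Finset.mem_singleton,
          Finset.mem_filter] at h1 h2
        rcases h1 with rfl | rfl
        · exact lt_irrefl _ h2.2.1
        · exact lt_irrefl _ h2.2.2.1
      · simp only [P, K, Finset.inr_mem_disjSum, Finset.mem_insert, Finset.mem_singleton,
          Finset.mem_filter] at h1 h2
        rcases h1 with rfl | rfl
        · exact lt_irrefl _ h2.2.1
        · exact lt_irrefl _ h2.2.2.1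
    have e := color_count T (P a) (K a) hd
    have hP : (P a).card = 4 := by
      simp only [P, Finset.card_disjSum]
      rw [Finset.card_pair q.lh.ne, Finset.card_pair q.lv.ne]
    have hK : (K a).card ≤ 4 * m := by
      simp only [K, Finset.card_disjSum]
      have h1 := q.nh
      have h2 := q.nv
      rw [Set.ncard_eq_toFinset_card'] at h1 h2
      simp only [Set.toFinset_ofPred] at h1 h2
      omega
    have hh := pow_half m _ hm hK
    rw [← hT] at hh
    rw [hP, ← hN] at e
    unfold Finset.bipartiteAbove
    rw [e]
    gcongr
  have hup : ∀ χ : H ⊕ V → Fin T, (S.bipartiteBelow rel χ).card ≤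
      4 * ((Finset.univ.filter fun h => χ (Sum.inl h) = 0).card +
        (Finset.univ.filter fun v => χ (Sum.inr v) = 0).card) := by
    intro χ
    refine corner_count hR hQ _ ?_
    intro a ha
    rw [Finset.mem_bipartiteBelow] at ha
    obtain ⟨ha, h1, h2⟩ := ha
    have q := hS a ha
    refine ⟨⟨?_, ?_, ?_, ?_, q.c0, q.c1, q.c2, q.lh, q.lv, ?_, ?_⟩, q.c3⟩
    · simpa using h1 (Sum.inl a.1) (by simp [P])
    · simpa using h1 (Sum.inl a.2.1) (by simp [P])
    · simpa using h1 (Sum.inr a.2.2.1) (by simp [P])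
    · simpa using h1 (Sum.inr a.2.2.2) (by simp [P])
    · intro g hg k1 k2 k3
      exact h2 (Sum.inl g) (by simp [K, k1, k2, k3]) (by simpa using hg)
    · intro g hg k1 k2 k3
      exact h2 (Sum.inr g) (by simp [K, k1, k2, k3]) (by simpa using hg)
  have hone : ∀ x : H ⊕ V, ((Finset.univ.filter fun χ : H ⊕ V → Fin T => χ x = 0).card : ℝ)
      = (T : ℝ) ^ N * (1 / T) := by
    intro x
    have := color_count T {x} ∅ (by simp)
    simpa [hN] using this
  have hsH := Finset.sum_card_bipartiteAbove_eq_sum_card_bipartiteBelow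
    (s := (Finset.univ : Finset (H ⊕ V → Fin T))) (t := (Finset.univ : Finset H))
    (fun χ h => χ (Sum.inl h) = 0)
  have hsV := Finset.sum_card_bipartiteAbove_eq_sum_card_bipartiteBelow
    (s := (Finset.univ : Finset (H ⊕ V → Fin T))) (t := (Finset.univ : Finset V))
    (fun χ h => χ (Sum.inr h) = 0)
  unfold Finset.bipartiteAbove Finset.bipartiteBelow at hsH hsV
  have hsH' : (∑ χ : H ⊕ V → Fin T, ((Finset.univ.filter fun h => χ (Sum.inl h) = 0).card : ℝ))
      = Fintype.card H * ((T : ℝ) ^ N * (1 / T)) := by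
    have : (∑ χ : H ⊕ V → Fin T, ((Finset.univ.filter fun h => χ (Sum.inl h) = 0).card : ℝ))
       = ∑ h : H, ((Finset.univ.filter fun χ : H ⊕ V → Fin T => χ (Sum.inl h) = 0).card : ℝ) := by
      exact_mod_cast hsH
    rw [this, Finset.sum_congr rfl fun x _ => hone (Sum.inl x)]
    simp
  have hsV' : (∑ χ : H ⊕ V → Fin T, ((Finset.univ.filter fun h => χ (Sum.inr h) = 0).card : ℝ))
      = Fintype.card V * ((T : ℝ) ^ N * (1 / T)) := by
    have : (∑ χ : H ⊕ V → Fin T, ((Finset.univ.filter fun h => χ (Sum.inr h) = 0).card : ℝ))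
       = ∑ h : V, ((Finset.univ.filter fun χ : H ⊕ V → Fin T => χ (Sum.inr h) = 0).card : ℝ) := by
      exact_mod_cast hsV
    rw [this, Finset.sum_congr rfl fun x _ => hone (Sum.inr x)]
    simp
  have hfin : (S.card : ℝ) * ((T : ℝ) ^ N * ((1 / T : ℝ) ^ 4 * (1 / 16))) ≤
      4 * ((Fintype.card H + Fintype.card V) * ((T : ℝ) ^ N * (1 / T))) := by
    calc (S.card : ℝ) * ((T : ℝ) ^ N * ((1 / T : ℝ) ^ 4 * (1 / 16)))
        = ∑ a ∈ S, ((T : ℝ) ^ N * ((1 / T : ℝ) ^ 4 * (1 / 16))) := by simp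
      _ ≤ ∑ a ∈ S, ((Finset.univ.bipartiteAbove rel a).card : ℝ) := Finset.sum_le_sum hlow
      _ = ∑ χ : H ⊕ V → Fin T, ((S.bipartiteBelow rel χ).card : ℝ) := by exact_mod_cast hdc
      _ ≤ ∑ χ : H ⊕ V → Fin T, (4 * (((Finset.univ.filter fun h => χ (Sum.inl h) = 0).card : ℝ) +
        ((Finset.univ.filter fun v => χ (Sum.inr v) = 0).card : ℝ))) :=
          Finset.sum_le_sum fun χ _ => by exact_mod_cast hup χ
      _ = _ := by
        rw [← Finset.mul_sum, Finset.sum_add_distrib, hsH', hsV']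
        ring
  rw [← hT]
  have hTN : (0 : ℝ) < (T : ℝ) ^ N := by positivity
  have e1 : (S.card : ℝ) * ((T : ℝ) ^ N * ((1 / T : ℝ) ^ 4 * (1 / 16)))
    = S.card * ((T : ℝ) ^ N * ((1 / T : ℝ) ^ 4 * (1 / 16))) := rfl
  have e2 : 4 * (((Fintype.card H : ℝ) + Fintype.card V) * ((T : ℝ) ^ N * (1 / T)))
    = (64 * (T : ℝ) ^ 3 * (Fintype.card H + Fintype.card V)) *
      ((T : ℝ) ^ N * ((1 / T : ℝ) ^ 4 * (1 / 16))) := by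
    field_simp
    ring
  rw [e2] at hfin
  exact le_of_mul_le_mul_right hfin (by positivity)

lemma split_finset {α : Type} [LinearOrder α] (s : Finset α) (m : ℕ) (h : 2 * m ≤ s.card) :
    ∃ Lo Hi : Finset α, Lo ⊆ s ∧ Hi ⊆ s ∧ Lo.card = m ∧ Hi.card = m ∧
      (∀ a ∈ Lo, ∀ b ∈ Hi, a < b) ∧
      (∀ a ∈ Lo, (s.filter fun x => x < a).card ≤ 2 * m) ∧
      (∀ a ∈ Hi, (s.filter fun x => x < a).card ≤ 2 * m) := by
  classical
  let e := s.orderEmbOfFin rfl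
  have hcount : ∀ a : Fin s.card, (s.filter fun x => x < e a).card ≤ a := by
    intro a
    have : (s.filter fun x => x < e a) ⊆ (Finset.Iio a).image e := by
      intro x hx
      rw [Finset.mem_filter] at hx
      have hx1 : x ∈ Set.range e := by
        rw [Finset.range_orderEmbOfFin]
        exact hx.1
      obtain ⟨b, rfl⟩ := hx1
      exact Finset.mem_image.mpr ⟨b, by simpa using hx.2, rfl⟩
    exact (Finset.card_le_card this).trans (Finset.card_image_le.trans (by simp))
  refine ⟨Finset.univ.image fun a : Fin m => e ⟨a, by omega⟩,
    Finset.univ.image fun a : Fin m => e ⟨m + a, by omega⟩, ?_, ?_, ?_, ?_, ?_, ?_, ?_⟩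
  · intro x hx
    obtain ⟨a, -, rfl⟩ := Finset.mem_image.mp hx
    exact Finset.orderEmbOfFin_mem s rfl _
  · intro x hx
    obtain ⟨a, -, rfl⟩ := Finset.mem_image.mp hx
    exact Finset.orderEmbOfFin_mem s rfl _
  · rw [Finset.card_image_of_injective _ (by
      intro a b hab
      have := e.injective hab
      simpa [Fin.ext_iff] using this)]
    simp
  · rw [Finset.card_image_of_injective _ (by
      intro a b hab
      have := e.injective hab
      simpa [Fin.ext_iff] using this)]
    simp
  · intro a ha b hb
    obtain ⟨a, -, rfl⟩ := Finset.mem_image.mp ha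
    obtain ⟨b, -, rfl⟩ := Finset.mem_image.mp hb
    apply e.strictMono
    rw [Fin.lt_def]
    simp only
    omega
  · intro a ha
    obtain ⟨a, -, rfl⟩ := Finset.mem_image.mp ha
    refine (hcount _).trans ?_
    simp only
    omega
  · intro a ha
    obtain ⟨a, -, rfl⟩ := Finset.mem_image.mp ha
    refine (hcount _).trans ?_
    simp only
    omega

section multi
variable {ι : Type} [Fintype ι] [DecidableEq ι] {V : ι → Type} [∀ i, LinearOrder (V i)]
  [∀ i, Fintype (V i)]

/-- hyperedges -/
def Ed (A : ∀ i j, V i → V j → Prop) (f : ∀ i, V i) : Prop :=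
  ∀ i j, i ≠ j → A i j (f i) (f j)

/-- later hyperedges in direction `i` -/
def Suc (A : ∀ i j, V i → V j → Prop) (f : ∀ i, V i) (i : ι) (b : V i) : Prop :=
  f i < b ∧ Ed A (Function.update f i b)

lemma ed_update {A : ∀ i j, V i → V j → Prop} {f : ∀ i, V i} (hf : Ed A f) (i : ι) (b : V i) :
    Ed A (Function.update f i b) ↔ ∀ k, k ≠ i → A i k b (f k) ∧ A k i (f k) b := by
  constructor
  · intro h k hk
    have h1 := h i k hk.symm
    have h2 := h k i hk
    simp only [Function.update_self, Function.update_of_ne hk] at h1 h2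
    exact ⟨h1, h2⟩
  · intro h k l hkl
    by_cases h1 : k = i
    · subst h1
      rw [Function.update_self, Function.update_of_ne hkl.symm]
      exact (h l hkl.symm).1
    · by_cases h2 : l = i
      · subst h2
        rw [Function.update_self, Function.update_of_ne hkl]
        exact (h k hkl).2
      · rw [Function.update_of_ne h1, Function.update_of_ne h2]
        exact hf k l hkl

/-- bad configurations in the plane `i, j` at `f` -/
def Bad (A : ∀ i j, V i → V j → Prop) (m : ℕ) (i j : ι) (f : ∀ i, V i) (b : V i) (c : V j) :
    Prop :=
  Suc A f i b ∧ Suc A f j c ∧ ¬ (A i j b c ∧ A j i c b) ∧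
    Set.ncard {x | Suc A f i x ∧ x < b} ≤ 2 * m ∧ Set.ncard {x | Suc A f j x ∧ x < c} ≤ 2 * m

def PR (A : ∀ i j, V i → V j → Prop) (i j : ι) (g : ∀ i, V i) (b : V i) (c : V j) : Prop :=
  A i j b c ∧ ∀ k, k ≠ i → k ≠ j → A i k b (g k) ∧ A k i (g k) b

lemma PX_left {A : ∀ i j, V i → V j → Prop} {i j : ι} (hij : i ≠ j) {f g : ∀ i, V i}
    (hf : Ed A f) (hg : ∀ k, k ≠ i → k ≠ j → g k = f k) (b : V i) :
    X (PR A i j g) (PR A j i g) b (f j) ↔ Ed A (Function.update f i b) := by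
  rw [ed_update hf]
  constructor
  · rintro ⟨⟨h1, h2⟩, ⟨h3, h4⟩⟩ k hk
    by_cases hkj : k = j
    · subst hkj
      exact ⟨h1, h3⟩
    · rw [← hg k hk hkj]
      exact h2 k hk hkj
  · intro h
    refine ⟨⟨(h j hij.symm).1, fun k h1 h2 => ?_⟩, ⟨(h j hij.symm).2, fun k h1 h2 => ?_⟩⟩
    · rw [hg k h1 h2]
      exact h k h1
    · rw [hg k h2 h1]
      exact ⟨hf j k h1.symm, hf k j h1⟩

lemma X_swap {H V : Type} {R : H → V → Prop} {Q : V → H → Prop} {h : H} {v : V} :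
    X R Q h v ↔ X Q R v h := and_comm

lemma PX_right {A : ∀ i j, V i → V j → Prop} {i j : ι} (hij : i ≠ j) {f g : ∀ i, V i}
    (hf : Ed A f) (hg : ∀ k, k ≠ i → k ≠ j → g k = f k) (c : V j) :
    X (PR A i j g) (PR A j i g) (f i) c ↔ Ed A (Function.update f j c) := by
  rw [X_swap]
  exact PX_left hij.symm hf (fun k h1 h2 => hg k h2 h1) c

open Classical in
lemma pair_count {A : ∀ i j, V i → V j → Prop}
    (hA : ∀ i j b x y z, x ≤ y → y ≤ z → A i j b x → A i j b z → A i j b y)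
    (m : ℕ) (hm : 1 ≤ m) (i j : ι) (hij : i ≠ j) :
    (Fintype.card (V i) : ℝ) * Fintype.card (V j) *
      ((Finset.univ.filter fun p : (∀ k, V k) × V i × V j =>
        Ed A p.1 ∧ Bad A m i j p.1 p.2.1 p.2.2).card : ℝ) ≤
      (∏ k, (Fintype.card (V k) : ℝ)) * (64 * ((2 * m : ℕ) : ℝ) ^ 3 *
        (Fintype.card (V i) + Fintype.card (V j))) := by
  let Pl : (∀ k, V k) → Finset (V i × V i × V j × V j) := fun g => Finset.univ.filter fun a =>
    Quad (fun h h' v => Set.ncard {x | h < x ∧ x < h' ∧ X (PR A i j g) (PR A j i g) x v} ≤ 2 * m)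
      (fun v v' h => Set.ncard {w | v < w ∧ w < v' ∧ X (PR A i j g) (PR A j i g) h w} ≤ 2 * m)
      (PR A i j g) (PR A j i g) a.1 a.2.1 a.2.2.1 a.2.2.2
  have hPl : ∀ g, ((Pl g).card : ℝ) ≤ 64 * ((2 * m : ℕ) : ℝ) ^ 3 *
        (Fintype.card (V i) + Fintype.card (V j)) := by
    intro g
    refine plane_count (R := PR A i j g) (Q := PR A j i g) ?_ ?_ m hm (Pl g) ?_
    · intro h a b c h1 h2 h3 h4
      exact ⟨hA _ _ _ _ _ _ h1 h2 h3.1 h4.1, h3.2⟩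
    · intro h a b c h1 h2 h3 h4
      exact ⟨hA _ _ _ _ _ _ h1 h2 h3.1 h4.1, h3.2⟩
    · intro a ha
      exact (Finset.mem_filter.mp ha).2
  have hinj := Finset.card_le_card_of_injOn
    (s := (Finset.univ : Finset (V i)) ×ˢ (Finset.univ : Finset (V j)) ×ˢ
      (Finset.univ.filter fun p : (∀ k, V k) × V i × V j =>
        Ed A p.1 ∧ Bad A m i j p.1 p.2.1 p.2.2))
    (t := (Finset.univ : Finset (∀ k, V k)).sigma Pl)
    (fun q => ⟨Function.update (Function.update q.2.2.1 i q.1) j q.2.1,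
      (q.2.2.1 i, q.2.2.2.1, q.2.2.1 j, q.2.2.2.2)⟩) ?_ ?_
  · rw [Finset.card_product, Finset.card_product, Finset.card_sigma] at hinj
    have h2 : (∑ g, ((Pl g).card : ℝ)) ≤ (∏ k, (Fintype.card (V k) : ℝ)) *
        (64 * ((2 * m : ℕ) : ℝ) ^ 3 * (Fintype.card (V i) + Fintype.card (V j))) := by
      refine (Finset.sum_le_sum fun g _ => hPl g).trans ?_
      simp
    refine le_trans ?_ h2
    rw [mul_assoc]
    exact_mod_cast hinj
  · rintro ⟨x, y, f, b, c⟩ hq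
    simp only [Finset.coe_product, Finset.coe_univ, Set.mem_prod, Set.mem_univ, true_and,
      Finset.coe_filter, Finset.mem_univ, Set.mem_ofPred_eq] at hq
    obtain ⟨hf, hb, hc, h3, h4, h5⟩ := hq
    simp only [Finset.coe_sigma, Set.mem_sigma_iff, Finset.coe_univ, Set.mem_univ, true_and,
      Finset.mem_coe, Pl, Finset.mem_filter, Finset.mem_univ]
    have hg : ∀ k, k ≠ i → k ≠ j → Function.update (Function.update f i x) j y k = f k := by
      intro k h1 h2
      rw [Function.update_of_ne h2, Function.update_of_ne h1]
    generalize Function.update (Function.update f i x) j y = g at hg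
    refine ⟨?_, ?_, ?_, ?_, hb.1, hc.1, ?_, ?_⟩
    · rw [PX_left hij hf hg, Function.update_eq_self]
      exact hf
    · rw [PX_left hij hf hg]
      exact hb.2
    · rw [PX_right hij hf hg]
      exact hc.2
    · exact fun h => h3 ⟨h.1.1, h.2.1⟩
    · refine le_of_eq_of_le ?_ h4
      congr 1
      ext z
      simp only [Set.mem_ofPred_eq, PX_left hij hf hg, Suc]
      tauto
    · refine le_of_eq_of_le ?_ h5
      congr 1
      ext z
      simp only [Set.mem_ofPred_eq, PX_right hij hf hg, Suc]
      tauto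
  · rintro ⟨x, y, f, b, c⟩ hq ⟨x', y', f', b', c'⟩ hq' h
    simp only [Sigma.mk.injEq, heq_eq_eq, Prod.mk.injEq] at h
    obtain ⟨h, h1, h2, h3, h4⟩ := h
    have hx : x = x' := by
      have := congrFun h i
      simpa [Function.update_of_ne hij] using this
    have hy : y = y' := by
      have := congrFun h j
      simpa using this
    have hff : f = f' := by
      funext k
      by_cases k1 : k = i
      · subst k1
        exact h1
      by_cases k2 : k = j
      · subst k2
        exact h3
      have := congrFun h k
      simpa [Function.update_of_ne k1, Function.update_of_ne k2] using this
    subst hx hy hff h2 h4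
    rfl

open Classical in
lemma last_count {A : ∀ i j, V i → V j → Prop} (T : ℕ) (i : ι) :
    (Fintype.card (V i) : ℝ) * ((Finset.univ.filter fun f : (∀ k, V k) =>
        Ed A f ∧ Set.ncard {b | Suc A f i b} < T).card : ℝ) ≤
      (∏ k, (Fintype.card (V k) : ℝ)) * T := by
  have hinj := Finset.card_le_card_of_injOn
    (s := (Finset.univ : Finset (V i)) ×ˢ (Finset.univ.filter fun f : (∀ k, V k) =>
        Ed A f ∧ Set.ncard {b | Suc A f i b} < T))
    (t := (Finset.univ : Finset (∀ k, V k)) ×ˢ Finset.range T)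
    (fun q => (Function.update q.2 i q.1, Set.ncard {b | Suc A q.2 i b})) ?_ ?_
  · rw [Finset.card_product, Finset.card_product] at hinj
    simp only [Finset.card_univ, Fintype.card_pi, Finset.card_range] at hinj
    exact_mod_cast hinj
  · rintro ⟨x, f⟩ hq
    simp only [Finset.coe_product, Finset.coe_univ, Set.mem_prod, Set.mem_univ, true_and,
      Finset.coe_filter, Finset.mem_univ, Set.mem_ofPred_eq] at hq
    simpa using hq.2
  · have key : ∀ f f' : (∀ k, V k), Ed A f → Ed A f' → (∀ k, k ≠ i → f k = f' k) → f i < f' i →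
        Set.ncard {b | Suc A f' i b} < Set.ncard {b | Suc A f i b} := by
      intro f f' hf hf' h hlt
      apply Set.ncard_lt_ncard _ (Set.toFinite _)
      have hu : ∀ b, Function.update f i b = Function.update f' i b := by
        intro b
        funext k
        by_cases k1 : k = i
        · subst k1
          simp
        · simp [Function.update_of_ne k1, h k k1]
      constructor
      · intro b hb
        exact ⟨hlt.trans hb.1, by rw [hu]; exact hb.2⟩
      · intro hc
        have : Suc A f i (f' i) := ⟨hlt, by rw [hu, Function.update_eq_self]; exact hf'⟩
        exact lt_irrefl _ (hc this).1
    rintro ⟨x, f⟩ hq ⟨x', f'⟩ hq' h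
    simp only [Finset.coe_product, Finset.coe_univ, Set.mem_prod, Set.mem_univ, true_and,
      Finset.coe_filter, Finset.mem_univ, Set.mem_ofPred_eq] at hq hq'
    simp only [Prod.mk.injEq] at h
    obtain ⟨h, h1⟩ := h
    have hx : x = x' := by
      have := congrFun h i
      simpa using this
    have hoff : ∀ k, k ≠ i → f k = f' k := by
      intro k hk
      have := congrFun h k
      simpa [Function.update_of_ne hk] using this
    have hi : f i = f' i := by
      rcases lt_trichotomy (f i) (f' i) with k | k | k
      · have := key f f' hq.1 hq'.1 hoff k
        omega
      · exact k
      · have := key f' f hq'.1 hq.1 (fun k hk => (hoff k hk).symm) k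
        omega
    have hff : f = f' := by
      funext k
      by_cases k1 : k = i
      · subst k1
        exact hi
      · exact hoff k k1
    rw [hx, hff]

open Classical in
lemma good_exists {A : ∀ i j, V i → V j → Prop}
    (hA : ∀ i j b x y z, x ≤ y → y ≤ z → A i j b x → A i j b z → A i j b y)
    (t : ℕ) (ht : 1 ≤ t) (f : ∀ i, V i) (hf : Ed A f)
    (h1 : ∀ i, 2 * (2 * t) ≤ Set.ncard {b | Suc A f i b})
    (h2 : ∀ i j, i ≠ j → 2 * Fintype.card ι * (Finset.univ.filter fun p : V i × V j =>
      Bad A (2 * t) i j f p.1 p.2).card < (2 * t) ^ 2) :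
    ∃ S : ∀ i, Finset (V i), (∀ i, (S i).card = t) ∧ ∀ f : (∀ i, V i), (∀ i, f i ∈ S i) → Ed A f := by
  have hsp : ∀ i, _ := fun i => split_finset (Finset.univ.filter fun b => Suc A f i b) (2 * t) (by
    have := h1 i
    rw [Set.ncard_eq_toFinset_card'] at this
    simpa using this)
  choose Lo Hi hLo hHi cLo cHi hlt bLo bHi using hsp
  have hsuc : ∀ i b, Suc A f i b → ∀ k, k ≠ i → A i k b (f k) ∧ A k i (f k) b := fun i b hb =>
    (ed_update hf i b).mp hb.2
  have sLo : ∀ i, ∀ b ∈ Lo i, Suc A f i b := fun i b hb => (Finset.mem_filter.mp (hLo i hb)).2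
  have sHi : ∀ i, ∀ b ∈ Hi i, Suc A f i b := fun i b hb => (Finset.mem_filter.mp (hHi i hb)).2
  have hq : ∀ i, ∃ q ∈ Hi i, ∀ b ∈ Hi i, q ≤ b := fun i =>
    Finset.exists_min_image (Hi i) id (Finset.card_pos.mp (by rw [cHi]; omega))
  choose q hqH hqmin using hq
  have hnc : ∀ i (b : V i), (Finset.univ.filter fun x => Suc A f i x).filter (fun x => x < b) =
      (Finset.univ.filter fun x => Suc A f i x ∧ x < b) := by
    intro i b
    rw [Finset.filter_filter]
  have nc : ∀ i (b : V i), Set.ncard {x | Suc A f i x ∧ x < b} =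
      ((Finset.univ.filter fun x => Suc A f i x).filter (fun x => x < b)).card := by
    intro i b
    rw [hnc, Set.ncard_eq_toFinset_card']
    congr 1
    ext x
    simp
  have hF : ∀ i j, i ≠ j →
      2 * Fintype.card ι * ((Lo i).filter fun b => ¬ A i j b (q j)).card < 2 * t := by
    intro i j hij
    have hsub : ((Lo i).filter fun b => ¬ A i j b (q j)) ×ˢ Hi j ⊆
        (Finset.univ.filter fun p : V i × V j => Bad A (2 * t) i j f p.1 p.2) := by
      rintro ⟨b, c⟩ hbc
      rw [Finset.mem_product, Finset.mem_filter] at hbc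
      obtain ⟨⟨hb, hbq⟩, hc⟩ := hbc
      simp only at hb hbq hc
      rw [Finset.mem_filter]
      refine ⟨Finset.mem_univ _, sLo i b hb, sHi j c hc, ?_, ?_, ?_⟩
      · rintro ⟨k, -⟩
        exact hbq (hA i j b (f j) (q j) c (sHi j _ (hqH j)).1.le (hqmin j c hc)
          (hsuc i b (sLo i b hb) j hij.symm).1 k)
      · rw [nc]
        exact bLo i b hb
      · rw [nc]
        exact bHi j c hc
    have h3 := Finset.card_le_card hsub
    rw [Finset.card_product, cHi] at h3
    have h4 := h2 i j hij
    by_contra hc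
    push Not at hc
    have h5 := Nat.mul_le_mul_left (2 * Fintype.card ι) h3
    have h6 := Nat.mul_le_mul_right (2 * t) hc
    nlinarith
  have hS : ∀ i, t ≤ ((Lo i).filter fun b => ∀ j, j ≠ i → A i j b (q j)).card := by
    intro i
    have hsplit := Finset.card_filter_add_card_filter_not (s := Lo i)
      (fun b => ∀ j, j ≠ i → A i j b (q j))
    have hsub : ((Lo i).filter fun b => ¬ ∀ j, j ≠ i → A i j b (q j)) ⊆
        (Finset.univ.filter fun j => j ≠ i).biUnion fun j => (Lo i).filter fun b => ¬ A i j b (q j) := by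
      intro b hb
      rw [Finset.mem_filter] at hb
      obtain ⟨hb, hb2⟩ := hb
      push Not at hb2
      obtain ⟨j, hj, hj2⟩ := hb2
      rw [Finset.mem_biUnion]
      exact ⟨j, by simpa using hj, by simp [hb, hj2]⟩
    have h3 := (Finset.card_le_card hsub).trans Finset.card_biUnion_le
    have h4 : 2 * Fintype.card ι * (∑ j ∈ Finset.univ.filter fun j => j ≠ i,
        ((Lo i).filter fun b => ¬ A i j b (q j)).card) ≤ Fintype.card ι * (2 * t) := by
      rw [Finset.mul_sum]
      refine (Finset.sum_le_card_nsmul _ _ (2 * t) ?_).trans ?_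
      · intro j hj
        exact (hF i j (by simpa using (Finset.mem_filter.mp hj).2.symm)).le
      · rw [smul_eq_mul]
        exact Nat.mul_le_mul_right _ (Finset.card_le_univ _)
    have hpos : 0 < Fintype.card ι := Fintype.card_pos_iff.mpr ⟨i⟩
    have h5 : (∑ j ∈ Finset.univ.filter fun j => j ≠ i,
        ((Lo i).filter fun b => ¬ A i j b (q j)).card) ≤ t := by
      by_contra hc
      push Not at hc
      have := Nat.mul_lt_mul_of_pos_left hc hpos
      nlinarith
    rw [cLo] at hsplit
    omega
  choose S hSsub hScard using fun i => Finset.exists_subset_card_eq (hS i)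
  refine ⟨S, hScard, ?_⟩
  intro g hg i j hij
  have hi := Finset.mem_filter.mp (hSsub i (hg i))
  have hj := Finset.mem_filter.mp (hSsub j (hg j))
  exact hA i j (g i) (f j) (g j) (q j) (sLo j _ hj.1).1.le (hlt j _ hj.1 _ (hqH j)).le
    (hsuc i _ (sLo i _ hi.1) j hij.symm).1 (hi.2 j hij.symm)

open Classical in
theorem abstract_bound [∀ i, Nonempty (V i)] {A : ∀ i j, V i → V j → Prop}
    (hA : ∀ i j b x y z, x ≤ y → y ≤ z → A i j b x → A i j b z → A i j b y)
    (t : ℕ) (ht : 1 ≤ t)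
    (hK : ¬ ∃ S : ∀ i, Finset (V i), (∀ i, (S i).card = t) ∧
      ∀ f : (∀ i, V i), (∀ i, f i ∈ S i) → Ed A f) :
    ((Finset.univ.filter fun f : (∀ i, V i) => Ed A f).card : ℝ) ≤
      (4 + 4096 * (Fintype.card ι : ℝ) ^ 2) *
      (t * (∏ k, (Fintype.card (V k) : ℝ)) * ∑ k, 1 / (Fintype.card (V k) : ℝ)) := by
  have hn : ∀ i, (0 : ℝ) < Fintype.card (V i) := fun i => by exact_mod_cast Fintype.card_pos
  obtain ⟨Pn, hPn⟩ : ∃ Pn : ℝ, Pn = ∏ k, (Fintype.card (V k) : ℝ) := ⟨_, rfl⟩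
  have hPn0 : 0 < Pn := by
    rw [hPn]
    exact Finset.prod_pos fun i _ => hn i
  have htR : (0 : ℝ) < t := by exact_mod_cast ht
  let B1 : ι → Finset (∀ k, V k) := fun i => Finset.univ.filter fun f : (∀ k, V k) =>
        Ed A f ∧ Set.ncard {b | Suc A f i b} < 2 * (2 * t)
  let B2 : ι × ι → Finset (∀ k, V k) := fun p => Finset.univ.filter fun f : (∀ k, V k) =>
        Ed A f ∧ p.1 ≠ p.2 ∧ (2 * t) ^ 2 ≤ 2 * Fintype.card ι *
          (Finset.univ.filter fun x : V p.1 × V p.2 => Bad A (2 * t) p.1 p.2 f x.1 x.2).card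
  have hcov : (Finset.univ.filter fun f : (∀ i, V i) => Ed A f) ⊆
      Finset.univ.biUnion B1 ∪ Finset.univ.biUnion B2 := by
    intro f hf
    have hf := (Finset.mem_filter.mp hf).2
    by_contra hc
    rw [Finset.mem_union, not_or] at hc
    simp only [Finset.mem_biUnion, Finset.mem_univ, true_and, not_exists, B1, B2,
      Finset.mem_filter] at hc
    refine hK (good_exists hA t ht f hf ?_ ?_)
    · intro i
      by_contra hh
      exact hc.1 i ⟨hf, not_le.mp hh⟩
    · intro i j hij
      by_contra hh
      exact hc.2 (i, j) ⟨hf, hij, not_lt.mp hh⟩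
  have hB1 : ∀ i, ((B1 i).card : ℝ) ≤ 4 * t * Pn * (1 / Fintype.card (V i)) := by
    intro i
    have := last_count (A := A) (2 * (2 * t)) i
    rw [← hPn] at this
    rw [mul_one_div, le_div_iff₀ (hn i)]
    refine le_trans (le_of_eq ?_) (this.trans (le_of_eq ?_))
    · simp only [B1]
      ring
    · push_cast
      ring
  have hB2 : ∀ p : ι × ι, ((B2 p).card : ℝ) ≤ 2048 * Fintype.card ι * t * Pn *
      (1 / Fintype.card (V p.1) + 1 / Fintype.card (V p.2)) := by
    rintro ⟨i, j⟩
    by_cases hij : i = j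
    · have : B2 (i, j) = ∅ := by
        simp [B2, hij]
      rw [this]
      have := hn i
      have := hn j
      simp only [Finset.card_empty, Nat.cast_zero]
      positivity
    have h1 := pair_count hA (2 * t) (by omega) i j hij
    rw [← hPn] at h1
    have h2 : (2 * t) ^ 2 * (B2 (i, j)).card ≤ 2 * Fintype.card ι *
      (Finset.univ.filter fun p : (∀ k, V k) × V i × V j =>
        Ed A p.1 ∧ Bad A (2 * t) i j p.1 p.2.1 p.2.2).card := by
      have h3 : ((B2 (i, j)).sigma fun f => (Finset.univ.filter fun x : V i × V j =>
          Bad A (2 * t) i j f x.1 x.2)).card ≤ (Finset.univ.filter fun p : (∀ k, V k) × V i × V j =>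
        Ed A p.1 ∧ Bad A (2 * t) i j p.1 p.2.1 p.2.2).card := by
        refine Finset.card_le_card_of_injOn (fun q => (q.1, q.2)) ?_ ?_
        · rintro ⟨f, x⟩ hq
          have hq := Finset.mem_sigma.mp (Finset.mem_coe.mp hq)
          have q1 := (Finset.mem_filter.mp hq.1).2.1
          have q2 := (Finset.mem_filter.mp hq.2).2
          simp only [Finset.coe_filter, Finset.mem_univ, true_and, Set.mem_ofPred_eq]
          exact ⟨q1, q2⟩
        · rintro ⟨f, x⟩ _ ⟨f', x'⟩ _ h
          simp only [Prod.mk.injEq] at h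
          obtain ⟨rfl, h⟩ := h
          have : x = x' := h
          subst this
          rfl
      rw [Finset.card_sigma] at h3
      refine le_trans ?_ (Nat.mul_le_mul_left _ h3)
      rw [Finset.mul_sum, mul_comm, ← smul_eq_mul]
      refine Finset.card_nsmul_le_sum _ _ _ ?_
      intro f hf
      exact (Finset.mem_filter.mp hf).2.2.2
    have h2' : (2 * (t : ℝ)) ^ 2 * (B2 (i, j)).card ≤ 2 * Fintype.card ι *
      ((Finset.univ.filter fun p : (∀ k, V k) × V i × V j =>
        Ed A p.1 ∧ Bad A (2 * t) i j p.1 p.2.1 p.2.2).card : ℝ) := by exact_mod_cast h2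
    generalize ((Finset.univ.filter fun p : (∀ k, V k) × V i × V j =>
        Ed A p.1 ∧ Bad A (2 * t) i j p.1 p.2.1 p.2.2).card : ℝ) = Z at h1 h2'
    generalize ((B2 (i, j)).card : ℝ) = Y at h2' ⊢
    have ni := hn i
    have nj := hn j
    push_cast at h1
    simp only
    generalize (Fintype.card (V i) : ℝ) = a at *
    generalize (Fintype.card (V j) : ℝ) = b at *
    generalize hD : (Fintype.card ι : ℝ) = D at *
    have hD0 : 0 ≤ D := by rw [← hD]; positivity
    have e : 2048 * D * t * Pn * (1 / a + 1 / b) = 2048 * D * t * Pn * (a + b) / (a * b) := by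
      field_simp
      ring
    rw [e, le_div_iff₀ (by positivity)]
    have h4 : (2 * (t : ℝ)) ^ 2 * (Y * (a * b)) ≤ (2 * (t : ℝ)) ^ 2 *
        (2048 * D * t * Pn * (a + b)) := by
      calc (2 * (t : ℝ)) ^ 2 * (Y * (a * b)) = ((2 * (t : ℝ)) ^ 2 * Y) * (a * b) := by ring
        _ ≤ (2 * D * Z) * (a * b) := by gcongr
        _ = 2 * D * (a * b * Z) := by ring
        _ ≤ 2 * D * (Pn * (64 * (2 * (2 * (t : ℝ))) ^ 3 * (a + b))) := by gcongr
        _ = _ := by ring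
    exact le_of_mul_le_mul_left h4 (by positivity)
  have hc1 : ((Finset.univ.filter fun f : (∀ i, V i) => Ed A f).card : ℝ) ≤
      ∑ i, ((B1 i).card : ℝ) + ∑ p, ((B2 p).card : ℝ) := by
    have := (Finset.card_le_card hcov).trans ((Finset.card_union_le _ _).trans
      (add_le_add Finset.card_biUnion_le Finset.card_biUnion_le))
    exact_mod_cast this
  refine hc1.trans ((add_le_add (Finset.sum_le_sum fun i _ => hB1 i)
    (Finset.sum_le_sum fun p _ => hB2 p)).trans (le_of_eq ?_))
  have hw : ∀ w : ι → ℝ, ∑ p : ι × ι, (w p.1 + w p.2) = 2 * Fintype.card ι * ∑ i, w i := by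
    intro w
    rw [Finset.sum_add_distrib, Fintype.sum_prod_type, Fintype.sum_prod_type]
    simp only [Finset.sum_const, Finset.card_univ, nsmul_eq_mul]
    rw [← Finset.mul_sum]
    ring
  have hw' := hw fun i => 1 / (Fintype.card (V i) : ℝ)
  rw [← Finset.mul_sum, ← Finset.mul_sum, hw', ← hPn]
  ring

end multi

end Zar

/-- the canonical case, `e(H) ≤ M_d · g_t(n_1,…,n_d)`. -/
theorem stmt9 (d : ℕ) (hd : 2 ≤ d) :
    ∃ M : ℝ, 0 < M ∧
      ∀ (t : ℕ), 2 ≤ t →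
      ∀ (n : Fin d → ℕ), (∀ i, 0 < n i) →
      ∀ (B : ∀ i : Fin d, Fin (n i) → Set (Fin d → ℝ)),
        Canonical n B → KFree t n B →
        (hyperedgeCount n B : ℝ) ≤ M * gZ t n := by
  refine ⟨4 + 4096 * (d : ℝ) ^ 2, by positivity, ?_⟩
  intro t ht n hn B hB hK
  choose lo hi hle hbox hdir using hB
  -- the fixed coordinate
  have hfix : ∀ i k, hi i k i = lo i k i := by
    intro i k
    have : i ∉ {j : Fin d | lo i k j < hi i k j} := by
      rw [← hdir i k]
      simp
    exact le_antisymm (not_lt.mp this) (hle i k i)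
  let A : ∀ i j : Fin d, Fin (n i) → Fin (n j) → Prop := fun i j b c =>
    lo j c j ∈ Set.Icc (lo i b j) (hi i b j)
  let κ : ∀ i, Fin (n i) → ℝ ×ₗ Fin (n i) := fun i k => toLex (lo i k i, k)
  have κinj : ∀ i, Function.Injective (κ i) := by
    intro i a b hab
    have := congrArg (fun x => (ofLex x).2) hab
    simpa [κ] using this
  let L : ∀ i, LinearOrder (Fin (n i)) := fun i => LinearOrder.lift' (κ i) (κinj i)
  have hmono : ∀ i (a b : Fin (n i)), (L i).le a b → lo i a i ≤ lo i b i := by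
    intro i a b hab
    have hab' : κ i a ≤ κ i b := hab
    rw [Prod.Lex.le_iff] at hab'
    rcases hab' with h | h
    · exact h.le
    · exact h.1.le
  have hE : ∀ f : (∀ i, Fin (n i)), (⋂ j, B j (f j)).Nonempty ↔ Zar.Ed A f := by
    intro f
    constructor
    · rintro ⟨x, hx⟩
      have hx' : ∀ j, ∀ k, x k ∈ Set.Icc (lo j (f j) k) (hi j (f j) k) := by
        intro j
        have := Set.mem_iInter.mp hx j
        rw [hbox] at this
        exact this
      intro i j _
      have h1 := hx' j j
      rw [hfix, Set.Icc_self, Set.mem_singleton_iff] at h1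
      have h2 := hx' i j
      rw [h1] at h2
      exact h2
    · intro h
      refine ⟨fun j => lo j (f j) j, Set.mem_iInter.mpr fun i => ?_⟩
      rw [hbox]
      intro j
      by_cases hij : i = j
      · subst hij
        exact ⟨le_rfl, hle _ _ _⟩
      · exact h i j hij
  have hne : ∀ i, Nonempty (Fin (n i)) := fun i => ⟨⟨0, hn i⟩⟩
  have key := @Zar.abstract_bound (Fin d) _ _ (fun i => Fin (n i)) L _ hne A ?_ t (by omega) ?_
  · unfold hyperedgeCount gZ
    simp only [Fintype.card_fin] at key
    refine le_trans (le_of_eq ?_) key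
    classical
    rw [Nat.card_eq_fintype_card, Fintype.card_subtype]
    congr 2
    ext f
    simp [hE]
  · intro i j b x y z hxy hyz hx hz
    exact ⟨hx.1.trans (hmono j x y hxy), (hmono j y z hyz).trans hz.2⟩
  · rintro ⟨S, h1, h2⟩
    exact hK ⟨S, h1, fun f hf => (hE f).mpr (h2 f hf)⟩
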